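/- Let (X,d) be a metric space, let f : X → ℝ be Lipschitz, and let γ : [0,1] → X be a geodesic. Then γ represents the gradient of f at time 0 if and only if the limit lim_{t↓0} (f(γ_t) − f(γ_0))/t exists and equals ½·lip f(γ_0)² + ½·|γ̇|². -/

import Mathlib

open Filter Topology Metric Set

open scoped Classical in
/-- The local Lipschitz constant (slope) of `f` at `x`:
`limsup_{y → x} |f y − f x| / dist y x` if `x` is not isolated, `0` otherwise. -/
noncomputable def locLip {X : Type*} [MetricSpace X] (f : X → ℝ) (x : X) : ℝ :=
  if (𝓝[≠] x).NeBot then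
    Filter.limsup (fun y => |f y - f x| / dist y x) (𝓝[≠] x)
  else 0

/-- A constant-speed geodesic parametrized on `[0,1]`:
`dist (γ s) (γ t) = |s − t| * dist (γ 0) (γ 1)` for all `s, t ∈ [0,1]`. -/
def IsGeodesic {X : Type*} [MetricSpace X] (γ : ℝ → X) : Prop :=
  ∀ s ∈ Set.Icc (0:ℝ) 1, ∀ t ∈ Set.Icc (0:ℝ) 1,
    dist (γ s) (γ t) = |s - t| * dist (γ 0) (γ 1)

/-- `γ` represents the gradient of `f` at time 0:
`liminf_{t↓0} (f(γ t) − f(γ 0))/t ≥ ½ lip f(γ 0)² + ½ |γ̇|²`,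
where `|γ̇| = dist (γ 0) (γ 1)` is the speed of the geodesic. -/
noncomputable def RepresentsGradAtZero {X : Type*} [MetricSpace X]
    (f : X → ℝ) (γ : ℝ → X) : Prop :=
  (1/2) * locLip f (γ 0) ^ 2 + (1/2) * dist (γ 0) (γ 1) ^ 2 ≤
    Filter.liminf (fun t : ℝ => (f (γ t) - f (γ 0)) / t) (𝓝[>] (0:ℝ))

theorem IsGeodesic.dist_zero {X : Type*} [MetricSpace X] {γ : ℝ → X} (hγ : IsGeodesic γ)
    {t : ℝ} (h0 : 0 < t) (h1 : t ≤ 1) : dist (γ t) (γ 0) = t * dist (γ 0) (γ 1) := by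
  simpa [abs_of_pos h0] using hγ t ⟨h0.le, h1⟩ 0 ⟨le_rfl, zero_le_one⟩

theorem eventually_mem_Ioc_zero_one : ∀ᶠ t in 𝓝[>] (0 : ℝ), t ∈ Ioc (0 : ℝ) 1 :=
  Ioc_mem_nhdsGT zero_lt_one

theorem IsGeodesic.eventually_abs_quotient_le {X : Type*} [MetricSpace X] {f : X → ℝ} {K : NNReal}
    (hf : LipschitzWith K f) {γ : ℝ → X} (hγ : IsGeodesic γ) :
    ∀ᶠ t in 𝓝[>] (0 : ℝ), |(f (γ t) - f (γ 0)) / t| ≤ K * dist (γ 0) (γ 1) := by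
  filter_upwards [eventually_mem_Ioc_zero_one] with t ht
  rw [abs_div, abs_of_pos ht.1, div_le_iff₀ ht.1, ← Real.dist_eq]
  calc dist (f (γ t)) (f (γ 0)) ≤ K * dist (γ t) (γ 0) := hf.dist_le_mul _ _
    _ = K * dist (γ 0) (γ 1) * t := by rw [hγ.dist_zero ht.1 ht.2]; ring

theorem IsGeodesic.tendsto_nhdsNE {X : Type*} [MetricSpace X] {γ : ℝ → X} (hγ : IsGeodesic γ)
    (hD : 0 < dist (γ 0) (γ 1)) : Tendsto γ (𝓝[>] (0 : ℝ)) (𝓝[≠] (γ 0)) := by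
  refine tendsto_nhdsWithin_iff.2 ⟨tendsto_iff_dist_tendsto_zero.2 ?_, ?_⟩
  · have h : Tendsto (fun t : ℝ => t * dist (γ 0) (γ 1)) (𝓝[>] (0 : ℝ)) (𝓝 0) := by
      have hcont : Continuous fun t : ℝ => t * dist (γ 0) (γ 1) := by fun_prop
      simpa using (hcont.tendsto 0).mono_left nhdsWithin_le_nhds
    refine h.congr' ?_
    filter_upwards [eventually_mem_Ioc_zero_one] with t ht
    rw [hγ.dist_zero ht.1 ht.2]
  · filter_upwards [eventually_mem_Ioc_zero_one] with t ht
    refine dist_pos.1 ?_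
    rw [hγ.dist_zero ht.1 ht.2]
    exact mul_pos ht.1 hD

/-- Every number above the local Lipschitz constant eventually bounds the difference quotients. -/
theorem LipschitzWith.eventually_quotient_lt_of_locLip_lt {X : Type*} [MetricSpace X] {f : X → ℝ}
    {K : NNReal} (hf : LipschitzWith K f) {x : X} {c : ℝ} (hc : locLip f x < c) :
    ∀ᶠ y in 𝓝[≠] x, |f y - f x| / dist y x < c := by
  by_cases hx : (𝓝[≠] x).NeBot
  · rw [locLip, if_pos hx] at hc
    refine eventually_lt_of_limsup_lt hc ?_
    refine isBoundedUnder_of ⟨K, fun y => ?_⟩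
    refine div_le_of_le_mul₀ dist_nonneg K.coe_nonneg ?_
    rw [← Real.dist_eq]
    exact hf.dist_le_mul _ _
  · rw [not_neBot.1 hx]
    exact eventually_bot

/-- The upper derivative of `f` along a geodesic is at most slope times speed. -/
theorem IsGeodesic.limsup_quotient_le {X : Type*} [MetricSpace X] {f : X → ℝ} {K : NNReal}
    (hf : LipschitzWith K f) {γ : ℝ → X} (hγ : IsGeodesic γ) :
    limsup (fun t : ℝ => (f (γ t) - f (γ 0)) / t) (𝓝[>] (0 : ℝ)) ≤
      locLip f (γ 0) * dist (γ 0) (γ 1) := by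
  have hbd := hγ.eventually_abs_quotient_le hf
  have hco : IsCoboundedUnder (· ≤ ·) (𝓝[>] (0 : ℝ))
      (fun t : ℝ => (f (γ t) - f (γ 0)) / t) :=
    IsBoundedUnder.isCoboundedUnder_le
      ⟨-(K * dist (γ 0) (γ 1)), eventually_map.2 (hbd.mono fun t ht => (abs_le.1 ht).1)⟩
  rcases (dist_nonneg (x := γ 0) (y := γ 1)).eq_or_lt with hD | hD
  · refine limsup_le_of_le hco (hbd.mono fun t ht => ?_)
    rw [← hD, mul_zero] at ht ⊢
    exact (abs_le.1 ht).2
  · rw [← div_le_iff₀ hD]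
    refine le_of_forall_gt_imp_ge_of_dense fun c hc => ?_
    rw [div_le_iff₀ hD]
    refine limsup_le_of_le hco ?_
    filter_upwards [eventually_mem_Ioc_zero_one,
      (hγ.tendsto_nhdsNE hD).eventually (hf.eventually_quotient_lt_of_locLip_lt hc)] with t ht htc
    rw [hγ.dist_zero ht.1 ht.2, div_lt_iff₀ (mul_pos ht.1 hD)] at htc
    rw [div_le_iff₀ ht.1]
    calc f (γ t) - f (γ 0) ≤ |f (γ t) - f (γ 0)| := le_abs_self _
      _ ≤ c * (t * dist (γ 0) (γ 1)) := htc.le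
      _ = c * dist (γ 0) (γ 1) * t := by ring

/-- `γ` represents the gradient of `f` at time 0 iff
`lim_{t↓0} (f(γ t) − f(γ 0))/t` exists and equals `½ lip f(γ 0)² + ½ |γ̇|²`. -/
theorem stmt4 {X : Type*} [MetricSpace X] (f : X → ℝ) (K : NNReal)
    (hf : LipschitzWith K f) (γ : ℝ → X) (hγ : IsGeodesic γ) :
    RepresentsGradAtZero f γ ↔
      Filter.Tendsto (fun t : ℝ => (f (γ t) - f (γ 0)) / t) (𝓝[>] (0:ℝ))
        (𝓝 ((1/2) * locLip f (γ 0) ^ 2 + (1/2) * dist (γ 0) (γ 1) ^ 2)) := by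
  refine ⟨fun h => ?_, fun h => h.liminf_eq.ge⟩
  have hbd := hγ.eventually_abs_quotient_le hf
  refine tendsto_of_le_liminf_of_limsup_le h ((hγ.limsup_quotient_le hf).trans ?_)
    ⟨K * dist (γ 0) (γ 1), eventually_map.2 (hbd.mono fun t ht => (abs_le.1 ht).2)⟩
    ⟨-(K * dist (γ 0) (γ 1)), eventually_map.2 (hbd.mono fun t ht => (abs_le.1 ht).1)⟩
  nlinarith [sq_nonneg (locLip f (γ 0) - dist (γ 0) (γ 1))]
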